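/- arXiv:2303.17450 — 2 statements merged into one kernel-verified Lean document; each statement's English description precedes it below -/
import Mathlib

section
/- In the component of Σᵢ₌₁⁸ fᵢ αᵢ (fᵢ ∈ F[∂₁,...,∂₄]) whose A-coefficients are divisible by the top exterior monomial ∂₅∂₆∂₇∂₈, the coefficient of aⱼ equals 2fⱼ∂₅∂₆∂₇∂₈ for j = 1,2,3,4 and fⱼ∂₅∂₆∂₇∂₈ for j = 5,6,7,8. -/
open scoped TensorProduct
open MvPolynomial

set_option synthInstance.maxHeartbeats 1000000
set_option maxHeartbeats 1000000

noncomputable section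

variable (F : Type) [Field F] [CharZero F]

/-- The polynomial part `F[∂₁,…,∂₄]` (even variables). -/
abbrev PolyPart := MvPolynomial (Fin 4) F

/-- The exterior (Grassmann) part `Λ(∂₅,…,∂₈)` on four odd generators. -/
abbrev ExtPart := ExteriorAlgebra F (Fin 4 → F)

/-- `A = F[∂₁,…,∂₄] ⊗ Λ(∂₅,…,∂₈)` (written with the exterior factor first). -/
abbrev AA := ExtPart F ⊗[F] PolyPart F

/-- The `i`-th odd generator of the exterior part. -/
def gen (i : Fin 4) : ExtPart F := ExteriorAlgebra.ι F (Pi.single i (1 : F))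

/-- The generators `∂₁,…,∂₈` of `A` (0-based: `dv 0,…,dv 3` are the even
generators `∂₁,…,∂₄`, and `dv 4,…,dv 7` are the odd generators `∂₅,…,∂₈`). -/
def dv (i : Fin 8) : AA F :=
  if h : (i : ℕ) < 4 then (1 : ExtPart F) ⊗ₜ[F] (X ⟨i, h⟩ : PolyPart F)
  else (gen F ⟨(i : ℕ) - 4, by omega⟩) ⊗ₜ[F] (1 : PolyPart F)

/-- The elements `ν₁,…,ν₄` (0-based: `nu 0 = ν₁ = ∂₆∂₇∂₈`, etc.). -/
def nu : Fin 4 → AA F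
  | 0 => dv F 5 * dv F 6 * dv F 7
  | 1 => -(dv F 4 * dv F 6 * dv F 7)
  | 2 => dv F 4 * dv F 5 * dv F 7
  | 3 => -(dv F 4 * dv F 5 * dv F 6)

/-- `ν` extended to all eight indices by `ν₅ = ⋯ = ν₈ = 0`. -/
def nu8 (i : Fin 8) : AA F :=
  if h : (i : ℕ) < 4 then nu F ⟨i, h⟩ else 0

/-- the embedding `{1,…,4} → {1,…,8}` , `i ↦ i` (even indices). -/
def ei (i : Fin 4) : Fin 8 := ⟨(i : ℕ), by omega⟩
/-- the embedding `{1,…,4} → {1,…,8}` , `i ↦ i + 4` (odd indices). -/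
def oi (i : Fin 4) : Fin 8 := ⟨(i : ℕ) + 4, by omega⟩

/-- The free `A`-module `R = A ⊗ F⁸` on the basis `a₁,…,a₈`, realized as
`Fin 8 → A` with basis the coordinate vectors. -/
abbrev MM := Fin 8 → AA F

/-- The basis elements `a₁,…,a₈` (0-based). -/
def av (i : Fin 8) : MM F := Pi.single i (1 : AA F)

/-- `B_{∂∂} = Σ_{i=1}^4 ∂ᵢ∂_{i+4}`. -/
def Bdd : AA F := ∑ i : Fin 4, dv F (ei i) * dv F (oi i)

/-- `C_{∂a} = Σ_{i=1}^4 (∂ᵢ a_{i+4} + ∂_{i+4} aᵢ)`. -/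
def Cda : MM F := ∑ i : Fin 4, (dv F (ei i) • av F (oi i) + dv F (oi i) • av F (ei i))

/-- `B_{νa} = Σ_{i=1}^4 νᵢ a_{i+4}`. -/
def Bnua : MM F := ∑ i : Fin 4, nu F i • av F (oi i)

/-- `αᵢ = ∂ᵢ B_{∂∂} C_{∂a} − 2 νᵢ C_{∂a} + ∂ᵢ B_{νa}` for `i = 1,…,8` (0-based). -/
def alph (i : Fin 8) : MM F :=
  (dv F i * Bdd F) • Cda F - (2 : ℤ) • (nu8 F i • Cda F) + dv F i • Bnua F

end
noncomputable section
variable (F : Type) [Field F] [CharZero F]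

/-- The product of the odd generators indexed by a subset `S ⊆ {5,…,8}`
(taken in increasing order): a basis monomial of the exterior part. -/
def extMonomial (S : Finset (Fin 4)) : ExtPart F :=
  ((S.sort (· ≤ ·)).map (gen F)).prod

/-- The span (over `F`) of all summands `(∂-monomial in Λ(∂₅,…,∂₈)) ⊗ q`,
`q ∈ F[∂₁,…,∂₄]`, whose exterior monomial is **not** the top monomial
`∂₅∂₆∂₇∂₈`: the complement of the component divisible by `∂₅∂₆∂₇∂₈` in the
direct-sum decomposition of `A` over exterior monomials. -/
def lowerPart : Submodule F (AA F) :=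
  Submodule.span F
    {x : AA F | ∃ (S : Finset (Fin 4)) (_ : S ≠ Finset.univ) (q : PolyPart F),
      x = extMonomial F S ⊗ₜ[F] q}

variable {F} in
theorem gen_sq (a : Fin 4) : gen F a * gen F a = 0 := ExteriorAlgebra.ι_sq_zero _

variable {F} in
theorem gen_anti (a b : Fin 4) : gen F b * gen F a = -(gen F a * gen F b) := by
  rw [eq_neg_iff_add_eq_zero]
  exact ExteriorAlgebra.ι_add_mul_swap _ _

theorem ext_sorted (l : List (Fin 4)) (h : l.Pairwise (· < ·)) :
    extMonomial F l.toFinset = (l.map (gen F)).prod := by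
  have hn : l.Nodup := h.imp (fun h => ne_of_lt h)
  have : l.toFinset.sort (· ≤ ·) = l :=
    (List.toFinset_sort (· ≤ ·) hn).2 (h.imp (fun h => le_of_lt h))
  unfold extMonomial
  rw [this]

theorem low_sorted (l : List (Fin 4)) (h : l.Pairwise (· < ·)) (hl : l.length < 4)
    (q : PolyPart F) : (l.map (gen F)).prod ⊗ₜ[F] q ∈ lowerPart F := by
  refine Submodule.subset_span ⟨l.toFinset, ?_, q, by rw [ext_sorted F l h]⟩
  intro hu
  have h1 := List.toFinset_card_le l
  rw [hu] at h1
  simp at h1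
  omega

theorem low1 (a : Fin 4) (q : PolyPart F) : gen F a ⊗ₜ[F] q ∈ lowerPart F := by
  simpa using low_sorted F [a] (by simp) (by simp) q

theorem low2 (a b : Fin 4) (q : PolyPart F) : (gen F a * gen F b) ⊗ₜ[F] q ∈ lowerPart F := by
  rcases lt_trichotomy a b with h | h | h
  · simpa using low_sorted F [a, b] (by simp [h]) (by simp) q
  · subst h; simp [gen_sq]
  · rw [gen_anti b a, TensorProduct.neg_tmul]
    exact neg_mem (by simpa using low_sorted F [b, a] (by simp [h]) (by simp) q)

theorem low3s (a b c : Fin 4) (hab : a < b) (q : PolyPart F) :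
    (gen F a * gen F b * gen F c) ⊗ₜ[F] q ∈ lowerPart F := by
  rcases lt_trichotomy b c with h | h | h
  · simpa [mul_assoc] using low_sorted F [a, b, c] (by simp [h, hab, hab.trans h]) (by simp) q
  · subst h; simp [gen_sq, mul_assoc]
  · rw [mul_assoc, gen_anti c b, mul_neg, TensorProduct.neg_tmul]
    apply neg_mem
    rcases lt_trichotomy a c with h' | h' | h'
    · simpa [mul_assoc] using low_sorted F [a, c, b] (by simp [h, hab, h']) (by simp) q
    · subst h'; simp [gen_sq, ← mul_assoc]
    · rw [← mul_assoc, gen_anti c a, neg_mul, TensorProduct.neg_tmul]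
      apply neg_mem
      simpa [mul_assoc] using low_sorted F [c, a, b] (by simp [h, hab, h']) (by simp) q

theorem low3 (a b c : Fin 4) (q : PolyPart F) :
    (gen F a * gen F b * gen F c) ⊗ₜ[F] q ∈ lowerPart F := by
  rcases lt_trichotomy a b with h | h | h
  · exact low3s F a b c h q
  · subst h; simp [gen_sq]
  · rw [gen_anti b a, neg_mul, TensorProduct.neg_tmul]
    exact neg_mem (low3s F b a c h q)

theorem low_mul (q : PolyPart F) (x : AA F) (hx : x ∈ lowerPart F) :
    ((1 : ExtPart F) ⊗ₜ[F] q : AA F) * x ∈ lowerPart F := by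
  unfold lowerPart at hx
  induction hx using Submodule.span_induction with
  | mem x h =>
    obtain ⟨S, hS, p, rfl⟩ := h
    rw [Algebra.TensorProduct.tmul_mul_tmul, one_mul]
    exact Submodule.subset_span ⟨S, hS, _, rfl⟩
  | zero => rw [mul_zero]; exact zero_mem _
  | add x y _ _ h1 h2 => rw [mul_add]; exact add_mem h1 h2
  | smul c x _ h => rw [mul_smul_comm]; exact Submodule.smul_mem _ _ h

theorem dv_ei (k : Fin 4) : dv F (ei k) = (1 : ExtPart F) ⊗ₜ[F] (X k : PolyPart F) := by
  simp [dv, ei]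

theorem dv_oi (k : Fin 4) : dv F (oi k) = gen F k ⊗ₜ[F] (1 : PolyPart F) := by
  simp [dv, oi]

/-- exterior part of `nu` -/
def nuE : Fin 4 → ExtPart F
  | 0 => gen F 1 * gen F 2 * gen F 3
  | 1 => -(gen F 0 * gen F 2 * gen F 3)
  | 2 => gen F 0 * gen F 1 * gen F 3
  | 3 => -(gen F 0 * gen F 1 * gen F 2)

theorem nu_eq (k : Fin 4) : nu F k = nuE F k ⊗ₜ[F] (1 : PolyPart F) := by
  have h4 : dv F 4 = _ := dv_oi F 0
  have h5 : dv F 5 = _ := dv_oi F 1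
  have h6 : dv F 6 = _ := dv_oi F 2
  have h7 : dv F 7 = _ := dv_oi F 3
  fin_cases k <;>
    simp [nu, nuE, h4, h5, h6, h7, Algebra.TensorProduct.tmul_mul_tmul, TensorProduct.neg_tmul]

theorem low_nu (k : Fin 4) (q : PolyPart F) : nuE F k ⊗ₜ[F] q ∈ lowerPart F := by
  fin_cases k <;> simp only [nuE, TensorProduct.neg_tmul, neg_mem_iff] <;> exact low3 F _ _ _ q

/-- top monomial -/
theorem top_eq : extMonomial F Finset.univ = gen F 0 * (gen F 1 * (gen F 2 * gen F 3)) := by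
  have h := ext_sorted F [0, 1, 2, 3] (by decide)
  have h2 : ([0, 1, 2, 3] : List (Fin 4)).toFinset = Finset.univ := by decide
  rw [h2] at h
  simpa using h

theorem gen_sq' (a : Fin 4) (x : ExtPart F) : gen F a * (gen F a * x) = 0 := by
  rw [← mul_assoc, gen_sq, zero_mul]

theorem gen_anti' (a b : Fin 4) (x : ExtPart F) :
    gen F b * (gen F a * x) = -(gen F a * (gen F b * x)) := by
  rw [← mul_assoc, gen_anti a b, neg_mul, mul_assoc]

theorem nuE_mul (i k : Fin 4) :
    nuE F i * gen F k = if i = k then -extMonomial F Finset.univ else 0 := by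
  rw [top_eq]
  fin_cases i <;> fin_cases k <;>
    simp [nuE, mul_assoc, gen_sq, gen_sq', gen_anti 0 1, gen_anti 0 2, gen_anti 0 3, gen_anti 1 2,
      gen_anti 1 3, gen_anti 2 3, gen_anti' F 0 1, gen_anti' F 0 2, gen_anti' F 0 3,
      gen_anti' F 1 2, gen_anti' F 1 3, gen_anti' F 2 3]

theorem mul_nuE (i k : Fin 4) :
    gen F k * nuE F i = if k = i then extMonomial F Finset.univ else 0 := by
  rw [top_eq]
  fin_cases i <;> fin_cases k <;>
    simp [nuE, mul_assoc, gen_sq, gen_sq', gen_anti 0 1, gen_anti 0 2, gen_anti 0 3, gen_anti 1 2,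
      gen_anti 1 3, gen_anti 2 3, gen_anti' F 0 1, gen_anti' F 0 2, gen_anti' F 0 3,
      gen_anti' F 1 2, gen_anti' F 1 3, gen_anti' F 2 3]

theorem Bdd_eq : Bdd F = ∑ l : Fin 4, gen F l ⊗ₜ[F] (X l : PolyPart F) := by
  simp [Bdd, dv_ei, dv_oi]

theorem ei_inj (a b : Fin 4) : ei a = ei b ↔ a = b := by simp [ei, Fin.ext_iff]
theorem oi_inj (a b : Fin 4) : oi a = oi b ↔ a = b := by simp [oi, Fin.ext_iff]
theorem ei_ne (a b : Fin 4) : ei a ≠ oi b := by simp [ei, oi, Fin.ext_iff]; omega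

theorem Cda_ei (k : Fin 4) : Cda F (ei k) = dv F (oi k) := by
  simp [Cda, av, Pi.single_apply, ei_inj, ei_ne]

theorem Cda_oi (k : Fin 4) : Cda F (oi k) = dv F (ei k) := by
  simp [Cda, av, Pi.single_apply, oi_inj, (ei_ne _ _).symm]

theorem Bnua_ei (k : Fin 4) : Bnua F (ei k) = 0 := by
  simp [Bnua, av, Pi.single_apply, ei_ne]

theorem Bnua_oi (k : Fin 4) : Bnua F (oi k) = nu F k := by
  simp [Bnua, av, Pi.single_apply, oi_inj]

theorem nu8_ei (k : Fin 4) : nu8 F (ei k) = nu F k := by simp [nu8, ei]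
theorem nu8_oi (k : Fin 4) : nu8 F (oi k) = 0 := by simp [nu8, oi]

theorem cases8 (i : Fin 8) : (∃ k, i = ei k) ∨ ∃ k, i = oi k := by
  by_cases h : (i : ℕ) < 4
  · exact Or.inl ⟨⟨i, h⟩, rfl⟩
  · exact Or.inr ⟨⟨i - 4, by omega⟩, by simp [oi, Fin.ext_iff]; omega⟩

theorem alph_apply (i j : Fin 8) : alph F i j =
    dv F i * Bdd F * Cda F j - (2 : ℤ) • (nu8 F i * Cda F j) + dv F i * Bnua F j := by
  simp [alph]

theorem alph_low (i j : Fin 8) :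
    alph F i j - (if i = j then extMonomial F Finset.univ ⊗ₜ[F]
      (if (j : ℕ) < 4 then 2 else 1 : PolyPart F) else 0) ∈ lowerPart F := by
  rw [alph_apply]
  rcases cases8 i with ⟨i, rfl⟩ | ⟨i, rfl⟩ <;> rcases cases8 j with ⟨j, rfl⟩ | ⟨j, rfl⟩
  · have h4 : ((ei j : Fin 8) : ℕ) < 4 := j.2
    rw [Cda_ei, Bnua_ei, nu8_ei, nu_eq, dv_oi, dv_ei, Bdd_eq, if_pos h4]
    simp only [ei_inj, Finset.mul_sum, Finset.sum_mul, Algebra.TensorProduct.tmul_mul_tmul,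
      nuE_mul, mul_zero, add_zero, one_mul, mul_one]
    have key : (2 : ℤ) • ((if i = j then -extMonomial F Finset.univ else 0) ⊗ₜ[F] (1 : PolyPart F))
        = - (if i = j then extMonomial F Finset.univ ⊗ₜ[F] (2 : PolyPart F) else 0) := by
      split_ifs
      · rw [← one_add_one_eq_two (R := PolyPart F), TensorProduct.tmul_add,
          TensorProduct.neg_tmul, two_smul]
        abel
      · simp
    rw [key, sub_neg_eq_add, add_sub_cancel_right]
    exact sum_mem fun l _ => low2 F _ _ _
  · rw [Cda_oi, Bnua_oi, nu8_ei, nu_eq, nu_eq, dv_ei, dv_ei, Bdd_eq, if_neg (ei_ne _ _), sub_zero]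
    simp only [Finset.mul_sum, Finset.sum_mul, Algebra.TensorProduct.tmul_mul_tmul,
      one_mul, mul_one]
    exact add_mem (sub_mem (sum_mem fun l _ => low1 F _ _) (zsmul_mem (low_nu F _ _) _))
      (low_nu F _ _)
  · rw [Cda_ei, Bnua_ei, nu8_oi, dv_oi, dv_oi, Bdd_eq, if_neg (ei_ne _ _).symm, sub_zero]
    simp only [Finset.mul_sum, Finset.sum_mul, Algebra.TensorProduct.tmul_mul_tmul,
      one_mul, mul_one, zero_mul, smul_zero, sub_zero, mul_zero, add_zero]
    exact sum_mem fun l _ => low3 F _ _ _ _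
  · have h4 : ¬ ((oi j : Fin 8) : ℕ) < 4 := by simp [oi]
    rw [Cda_oi, Bnua_oi, nu8_oi, nu_eq, dv_oi, dv_ei, Bdd_eq, if_neg h4]
    simp only [oi_inj, Finset.mul_sum, Finset.sum_mul, Algebra.TensorProduct.tmul_mul_tmul,
      mul_nuE, one_mul, mul_one, zero_mul, smul_zero, sub_zero]
    have key : ((if i = j then extMonomial F Finset.univ else 0) ⊗ₜ[F] (1 : PolyPart F))
        = (if i = j then extMonomial F Finset.univ ⊗ₜ[F] (1 : PolyPart F) else 0) := by
      split_ifs <;> simp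
    rw [key, add_sub_cancel_right]
    exact sum_mem fun l _ => low2 F _ _ _

/-- In `Σᵢ fᵢ αᵢ` with `fᵢ ∈ F[∂₁,…,∂₄]`, the component of the
coefficient of `aⱼ` divisible by the top exterior monomial `∂₅∂₆∂₇∂₈` equals
`2 fⱼ ∂₅∂₆∂₇∂₈` for `j = 1,2,3,4` and `fⱼ ∂₅∂₆∂₇∂₈` for `j = 5,6,7,8`. -/
theorem stmt7 :
    ∀ (f : Fin 8 → PolyPart F) (j : Fin 8),
      ∃ rest ∈ lowerPart F,
        (∑ i : Fin 8, ((1 : ExtPart F) ⊗ₜ[F] f i : AA F) • alph F i) j =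
          extMonomial F Finset.univ ⊗ₜ[F]
              ((if (j : ℕ) < 4 then 2 else 1) * f j) + rest := by
  intro f j
  refine ⟨∑ i : Fin 8, ((1 : ExtPart F) ⊗ₜ[F] f i : AA F) * (alph F i j - (if i = j then
    extMonomial F Finset.univ ⊗ₜ[F] (if (j : ℕ) < 4 then 2 else 1 : PolyPart F) else 0)),
    sum_mem fun i _ => low_mul F _ _ (alph_low F i j), ?_⟩
  generalize (if (j : ℕ) < 4 then 2 else 1 : PolyPart F) = c
  simp only [mul_sub, Finset.sum_sub_distrib, mul_ite, mul_zero, Finset.sum_ite_eq',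
    Finset.mem_univ, if_true, Algebra.TensorProduct.tmul_mul_tmul, one_mul, Finset.sum_apply,
    Pi.smul_apply, smul_eq_mul]
  rw [mul_comm (f j)]
  abel

end
end

section
/- In the Lie conformal superalgebra RW(r,s) (the free F[∂₁,...,∂_{r+s}]-module on generators a₁,...,a_{r+s}, with aᵢ even for i ≤ r and odd for i > r, and λ-bracket [aᵢ_λ aⱼ] = (∂ᵢ+λᵢ)aⱼ + aᵢλⱼ extended by sesquilinearity), the bracket satisfies conformal skew-symmetry: [aⱼ_λ aᵢ] = −(−1)^{pᵢpⱼ}[aᵢ_{−λ−∂} aⱼ], and the conformal Jacobi identity [aᵢ_λ [aⱼ_μ aₖ]] = [[aᵢ_λ aⱼ]_{λ+μ} aₖ] + (−1)^{pᵢpⱼ}[aⱼ_μ [aᵢ_λ aₖ]] for all i,j,k. -/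
open scoped TensorProduct
open MvPolynomial

set_option synthInstance.maxHeartbeats 1000000
set_option maxHeartbeats 1000000

noncomputable section

variable (F : Type) [Field F] [CharZero F] (r s : ℕ)

/-- The supercommutative algebra `F[∂, λ, μ]` on three sets of variables
(set `0` = `∂`, set `1` = `λ`, set `2` = `μ`), each set consisting of `r` even
and `s` odd variables. -/
abbrev CW := ExteriorAlgebra F ((Fin 3 × Fin s) → F) ⊗[F]
  MvPolynomial (Fin 3 × Fin r) F

/-- The `i`-th variable of the `t`-th set (`∂ᵢ`, `λᵢ` or `μᵢ`). -/
def vr (t : Fin 3) (i : Fin (r + s)) : CW F r s :=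
  if h : (i : ℕ) < r then
    (1 : ExteriorAlgebra F ((Fin 3 × Fin s) → F)) ⊗ₜ[F] (X (t, ⟨i, h⟩))
  else
    (ExteriorAlgebra.ι F (Pi.single (t, ⟨(i : ℕ) - r, by omega⟩) (1 : F)))
      ⊗ₜ[F] 1

/-- Parity of the index `i` (`true` = odd, i.e. `i > r`). -/
def pp (i : Fin (r + s)) : Bool := decide (r ≤ (i : ℕ))

/-- `(−1)^b`. -/
def sg (b : Bool) : ℤ := if b then -1 else 1

/-- The free module `F[∂,λ,μ] ⊗ F^{r+s}` on the generators `a₁,…,a_{r+s}`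
(elements as coefficient vectors, coefficients written on the left). -/
abbrev MW := Fin (r + s) → CW F r s

/-- The generator `aᵢ`. -/
def aw (i : Fin (r + s)) : MW F r s := Pi.single i (1 : CW F r s)

/-- The generator formula of `RW(r,s)` with the `λ`-variables in set `t`:
`[aᵢ_λ aⱼ] = (∂ᵢ + λᵢ)aⱼ + aᵢλⱼ`. -/
def brGen (t : Fin 3) (i j : Fin (r + s)) : MW F r s :=
  (vr F r s 0 i + vr F r s t i) • aw F r s j
    + sg (pp r s i && pp r s j) • (vr F r s t j • aw F r s i)

/-- `[aⱼ_{λ+μ} aₖ]` (the generator formula at `λ + μ`). -/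
def brGenSum (j k : Fin (r + s)) : MW F r s :=
  (vr F r s 0 j + vr F r s 1 j + vr F r s 2 j) • aw F r s k
    + sg (pp r s j && pp r s k) •
        ((vr F r s 1 k + vr F r s 2 k) • aw F r s j)

/-- Right multiplication of a module element by the variable `vr t i`
(with the Koszul signs coming from moving it past the generators). -/
def rmulV (t : Fin 3) (i : Fin (r + s)) (w : MW F r s) : MW F r s :=
  fun k => sg (pp r s i && pp r s k) • (w k * vr F r s t i)

/-- `[aᵢ_λ [aⱼ_μ aₖ]]`, expanded using conformal sesquilinearity:
`[aⱼ_μ aₖ] = (∂ⱼ + μⱼ)aₖ + aⱼμⱼ`, `[a_λ (b ∂ⱼ)] = [a_λ b](∂ⱼ + λⱼ)`, and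
`F[μ]`-scalars pass out with the Koszul sign. -/
def jacLHS (i j k : Fin (r + s)) : MW F r s :=
  sg (pp r s j && pp r s k) •
      (rmulV F r s 0 j (brGen F r s 1 i k) + rmulV F r s 1 j (brGen F r s 1 i k))
    + sg (pp r s j && pp r s i) • (vr F r s 2 j • brGen F r s 1 i k)
    + (sg (pp r s j && pp r s k) * sg (pp r s k && pp r s i)) •
        (vr F r s 2 k • brGen F r s 1 i j)

/-- `[[aᵢ_λ aⱼ]_{λ+μ} aₖ]`, expanded using `[(∂ᵢa)_ν b] = −νᵢ[a_ν b]` and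
`F[λ]`-linearity in the coefficients. -/
def jacMid (i j k : Fin (r + s)) : MW F r s :=
  -((vr F r s 1 i + vr F r s 2 i) • brGenSum F r s j k)
    + vr F r s 1 i • brGenSum F r s j k
    + sg (pp r s i && pp r s j) • (vr F r s 1 j • brGenSum F r s i k)

/-- `[aⱼ_μ [aᵢ_λ aₖ]]`, expanded as in `jacLHS`. -/
def jacRHS2 (i j k : Fin (r + s)) : MW F r s :=
  sg (pp r s i && pp r s k) •
      (rmulV F r s 0 i (brGen F r s 2 j k) + rmulV F r s 2 i (brGen F r s 2 j k))
    + sg (pp r s i && pp r s j) • (vr F r s 1 i • brGen F r s 2 j k)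
    + (sg (pp r s i && pp r s k) * sg (pp r s k && pp r s j)) •
        (vr F r s 1 k • brGen F r s 2 j i)

theorem vr_comm (t u : Fin 3) (i j : Fin (r + s)) :
    vr F r s t i * vr F r s u j
      = sg (pp r s i && pp r s j) • (vr F r s u j * vr F r s t i) := by
  unfold vr pp sg
  by_cases hi : (i : ℕ) < r <;> by_cases hj : (j : ℕ) < r
  · simp [hi, hj, mul_comm]
  · simp [hi, hj]
  · simp [hi, hj]
  · have h := ExteriorAlgebra.ι_add_mul_swap (R := F)
      (Pi.single (M := fun _ : Fin 3 × Fin s => F) (t, (⟨(i : ℕ) - r, by omega⟩ : Fin s)) (1 : F))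
      (Pi.single (M := fun _ : Fin 3 × Fin s => F) (u, (⟨(j : ℕ) - r, by omega⟩ : Fin s)) (1 : F))
    have h2 := eq_neg_of_add_eq_zero_left h
    simp only [hi, hj, dite_false, Algebra.TensorProduct.tmul_mul_tmul, h2]
    simp [not_lt.mp hi, not_lt.mp hj, TensorProduct.neg_tmul]

theorem rmulV_add (t : Fin 3) (i : Fin (r + s)) (w z : MW F r s) :
    rmulV F r s t i (w + z) = rmulV F r s t i w + rmulV F r s t i z := by
  funext k
  simp [rmulV, add_mul, smul_add]

theorem rmulV_zsmul (t : Fin 3) (i : Fin (r + s)) (n : ℤ) (w : MW F r s) :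
    rmulV F r s t i (n • w) = n • rmulV F r s t i w := by
  funext k
  simp only [rmulV, Pi.smul_apply, smul_mul_assoc]
  rw [smul_comm]

theorem rmulV_aw (t : Fin 3) (i k : Fin (r + s)) (c : CW F r s) :
    rmulV F r s t i (c • aw F r s k)
      = sg (pp r s i && pp r s k) • ((c * vr F r s t i) • aw F r s k) := by
  funext l
  by_cases h : l = k
  · subst h
    simp [rmulV, aw]
  · simp [rmulV, aw, h]

theorem comb_zero {A M : Type*} [Ring A] [AddCommGroup M] [Module A M]
    (s1 s2 s3 : ℤ) (h1 : s1 = 1 ∨ s1 = -1) (h2 : s2 = 1 ∨ s2 = -1) (h3 : s3 = 1 ∨ s3 = -1)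
    (di li mi dj lj mj lk mk : A) (ai aj ak : M)
    (c1 : dj * di = s1 • (di * dj)) (c2 : dj * mi = s1 • (mi * dj))
    (c3 : mj * di = s1 • (di * mj)) (c4 : mj * mi = s1 • (mi * mj))
    (c5 : mj * li = s1 • (li * mj)) (c6 : lj * di = s1 • (di * lj))
    (c7 : lj * li = s1 • (li * lj)) (c8 : lj * mi = s1 • (mi * lj))
    (e1 : mk * di = s2 • (di * mk)) (e2 : mk * li = s2 • (li * mk))
    (e3 : mk * mi = s2 • (mi * mk)) (e4 : lk * mi = s2 • (mi * lk))
    (f1 : lk * dj = s3 • (dj * lk)) (f2 : lk * lj = s3 • (lj * lk))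
    (f3 : lk * mj = s3 • (mj * lk)) (f4 : mk * lj = s3 • (lj * mk)) :
    s3 • ((s3 • (((di + li) * dj) • ak) + s2 • (s1 • ((lk * dj) • ai)))
        + (s3 • (((di + li) * lj) • ak) + s2 • (s1 • ((lk * lj) • ai))))
      + s1 • (mj • ((di + li) • ak + s2 • (lk • ai)))
      + (s3 * s2) • (mk • ((di + li) • aj + s1 • (lj • ai)))
    = (-((li + mi) • ((dj + lj + mj) • ak + s3 • ((lk + mk) • aj)))
        + li • ((dj + lj + mj) • ak + s3 • ((lk + mk) • aj))
        + s1 • (lj • ((di + li + mi) • ak + s2 • ((lk + mk) • ai))))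
      + s1 • (s2 • ((s2 • (((dj + mj) * di) • ak) + s3 • (s1 • ((mk * di) • aj)))
          + (s2 • (((dj + mj) * mi) • ak) + s3 • (s1 • ((mk * mi) • aj))))
        + s1 • (li • ((dj + mj) • ak + s3 • (mk • aj)))
        + (s2 * s3) • (lk • ((dj + mj) • ai + s1 • (mi • aj)))) := by
  rcases h1 with rfl | rfl <;> rcases h2 with rfl | rfl <;> rcases h3 with rfl | rfl <;>
  · simp only [one_smul, neg_smul, smul_neg, smul_add, smul_smul, mul_one, one_mul, neg_neg, mul_neg, neg_mul,
      add_mul, mul_add, add_smul, c1, c2, c3, c4, c5, c6, c7, c8, e1, e2, e3, e4, f1, f2, f3, f4]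
    abel

theorem skew_aux {A : Type*} [Ring A] (n : ℤ) (h : n = 1 ∨ n = -1) (di li dj lj x y : A) :
    (dj + lj) * x + n • (li * y)
      = -(n • ((di + (-li - di)) * y + n • ((-lj - dj) * x))) := by
  rcases h with rfl | rfl <;> simp only [one_smul, neg_smul] <;> noncomm_ring

theorem sg_cases (b : Bool) : sg b = 1 ∨ sg b = -1 := by
  cases b <;> simp [sg]

/-- In `RW(r,s)` the bracket satisfies conformal
skew-symmetry `[aⱼ_λ aᵢ] = −(−1)^{pᵢpⱼ}[aᵢ_{−λ−∂} aⱼ]` (the substitution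
`λ ↦ −λ−∂` being the superalgebra endomorphism `ψ` of `F[∂,λ,μ]` fixing `∂`
and `μ` and sending `λᵢ ↦ −λᵢ−∂ᵢ`), and the conformal Jacobi identity
`[aᵢ_λ[aⱼ_μ aₖ]] = [[aᵢ_λ aⱼ]_{λ+μ} aₖ] + (−1)^{pᵢpⱼ}[aⱼ_μ[aᵢ_λ aₖ]]`
for all `i, j, k`. -/
theorem stmt14 :
    (∀ ψ : CW F r s →ₐ[F] CW F r s,
      (∀ i, ψ (vr F r s 1 i) = -vr F r s 1 i - vr F r s 0 i) →
      (∀ i, ψ (vr F r s 0 i) = vr F r s 0 i) →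
      (∀ i, ψ (vr F r s 2 i) = vr F r s 2 i) →
      ∀ i j : Fin (r + s),
        brGen F r s 1 j i =
          -(sg (pp r s i && pp r s j) •
              fun k => ψ (brGen F r s 1 i j k))) ∧
    (∀ i j k : Fin (r + s),
      jacLHS F r s i j k =
        jacMid F r s i j k
          + sg (pp r s i && pp r s j) • jacRHS2 F r s i j k) := by
  constructor
  · intro ψ h1 h0 h2 i j
    have hc : (pp r s j && pp r s i) = (pp r s i && pp r s j) := Bool.and_comm _ _
    funext l
    have e : ∀ i l, ψ (aw F r s i l) = aw F r s i l := by
      intro i l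
      by_cases h : l = i
      · subst h
        simp [aw]
      · simp [aw, h]
    simp only [brGen, Pi.add_apply, Pi.smul_apply, Pi.neg_apply, map_add, smul_eq_mul, map_mul,
      map_zsmul, h1, h0, e, hc]
    exact skew_aux _ (sg_cases _) _ _ _ _ _ _
  · intro i j k
    have h1 : (pp r s j && pp r s i) = (pp r s i && pp r s j) := Bool.and_comm _ _
    have h2 : (pp r s k && pp r s i) = (pp r s i && pp r s k) := Bool.and_comm _ _
    have h3 : (pp r s k && pp r s j) = (pp r s j && pp r s k) := Bool.and_comm _ _
    have c1 := fun t u => vr_comm F r s t u j i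
    have c2 := fun t u => vr_comm F r s t u k i
    have c3 := fun t u => vr_comm F r s t u k j
    simp only [h1, h2, h3] at c1 c2 c3
    simp only [jacLHS, jacMid, jacRHS2, brGen, brGenSum, rmulV_add, rmulV_zsmul, rmulV_aw,
      h1, h2, h3]
    apply comb_zero _ _ _ (sg_cases _) (sg_cases _) (sg_cases _) <;>
      first | exact c1 _ _ | exact c2 _ _ | exact c3 _ _

end
end
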